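/- Let n ≥ 1, for each i ∈ Fin n let Xᵢ be a nonempty metric space and gᵢ : Xᵢ → Xᵢ a map, and let N : (Fin n → ℝ) → ℝ be a W-invariant norm on ℝⁿ. Then ⨅_{x ∈ ∏ᵢ Xᵢ} N (fun i => dist (x i) (gᵢ (x i))) = N (fun i => ⨅_{y ∈ Xᵢ} dist y (gᵢ y)). That is, the translation length of the product map g = (gᵢ)ᵢ on ∏ᵢ Xᵢ for the N-metric d_N x y := N (fun i => dist (x i) (y i)) equals N applied to the vector of translation lengths of the factors. -/

import Mathlib

/-- Multiplying one coordinate by a scalar of absolute value at most one does not increase a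
sign-invariant seminorm. -/
theorem signInvariant_update_mul_le {ι : Type*} [DecidableEq ι] (N : (ι → ℝ) → ℝ)
    (hadd : ∀ x y : ι → ℝ, N (x + y) ≤ N x + N y)
    (hhom : ∀ (c : ℝ) (x : ι → ℝ), N (c • x) = |c| * N x)
    (hW : ∀ ε : ι → ℝ, (∀ i, ε i ∈ ({1, -1} : Set ℝ)) →
      ∀ x : ι → ℝ, N (fun i => ε i * x i) = N x)
    (x : ι → ℝ) (j : ι) (c : ℝ) (hc : |c| ≤ 1) :
    N (Function.update x j (c * x j)) ≤ N x := by
  obtain ⟨hc₁, hc₂⟩ := abs_le.mp hc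
  have hflip := hW (fun i => if i = j then -1 else 1)
    (fun i => by by_cases h : i = j <;> simp [h]) x
  have hdecomp : Function.update x j (c * x j) = ((1 + c) / 2) • x +
      ((1 - c) / 2) • (fun i => (if i = j then (-1 : ℝ) else 1) * x i) := by
    ext i
    by_cases h : i = j
    · subst h
      simp only [Function.update_self, Pi.add_apply, Pi.smul_apply, smul_eq_mul, if_true]
      ring
    · simp only [Function.update_of_ne h, Pi.add_apply, Pi.smul_apply, smul_eq_mul, if_neg h]
      ring
  rw [hdecomp]
  refine (hadd _ _).trans (le_of_eq ?_)
  rw [hhom, hhom, hflip, abs_of_nonneg (by linarith), abs_of_nonneg (by linarith)]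
  ring

/-- A sign-invariant seminorm on `ι → ℝ` is monotone in the absolute values of the
coordinates. -/
theorem signInvariant_mono {ι : Type*} [Fintype ι] (N : (ι → ℝ) → ℝ)
    (hadd : ∀ x y : ι → ℝ, N (x + y) ≤ N x + N y)
    (hhom : ∀ (c : ℝ) (x : ι → ℝ), N (c • x) = |c| * N x)
    (hW : ∀ ε : ι → ℝ, (∀ i, ε i ∈ ({1, -1} : Set ℝ)) →
      ∀ x : ι → ℝ, N (fun i => ε i * x i) = N x)
    {a b : ι → ℝ} (hab : ∀ i, |a i| ≤ |b i|) : N a ≤ N b := by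
  classical
  have key : ∀ s : Finset ι, N (fun i => if i ∈ s then a i else b i) ≤ N b := by
    intro s
    induction s using Finset.induction_on with
    | empty => simp
    | insert j s hj ih =>
      refine le_trans (le_of_eq ?_) ((signInvariant_update_mul_le N hadd hhom hW
        (fun i => if i ∈ s then a i else b i) j (a j / b j) ?_).trans ih)
      · congr 1
        ext i
        by_cases h : i = j
        · subst h
          have hmul : a i / b i * b i = a i :=
            div_mul_cancel_of_imp fun hb => by simpa [hb] using hab i
          simp [hj, hmul]
        · simp [h]
      · rw [abs_div]
        exact div_le_one_of_le₀ (hab j) (abs_nonneg _)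
  simpa using key Finset.univ


/-- For a W-invariant norm `N` on ℝⁿ, the translation length of the product map
`g = (gᵢ)ᵢ` on `∏ᵢ Xᵢ` for the `N`-metric equals `N` applied to the vector of
translation lengths of the factors. -/
theorem translationLength_product_norm
    (n : ℕ) (hn : 1 ≤ n) (X : Fin n → Type*)
    [∀ i, MetricSpace (X i)] [∀ i, Nonempty (X i)]
    (g : ∀ i, X i → X i)
    (N : (Fin n → ℝ) → ℝ)
    (hadd : ∀ x y : Fin n → ℝ, N (x + y) ≤ N x + N y)
    (hhom : ∀ (c : ℝ) (x : Fin n → ℝ), N (c • x) = |c| * N x)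
    (hdef : ∀ x : Fin n → ℝ, N x = 0 → x = 0)
    (hW : ∀ ε : Fin n → ℝ, (∀ i, ε i ∈ ({1, -1} : Set ℝ)) →
      ∀ x : Fin n → ℝ, N (fun i => ε i * x i) = N x) :
    (⨅ x : ∀ i, X i, N (fun i => dist (x i) (g i (x i)))) =
      N (fun i => ⨅ y : X i, dist y (g i y)) := by
  have hdist (i : Fin n) : BddBelow (Set.range fun y : X i => dist y (g i y)) :=
    ⟨0, by rintro _ ⟨y, rfl⟩; exact dist_nonneg⟩
  have hL (i : Fin n) : 0 ≤ ⨅ y : X i, dist y (g i y) := Real.iInf_nonneg fun _ => dist_nonneg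
  have hlower (x : ∀ i, X i) : N (fun i => ⨅ y : X i, dist y (g i y)) ≤
      N (fun i => dist (x i) (g i (x i))) :=
    signInvariant_mono N hadd hhom hW fun i =>
      abs_le_abs_of_nonneg (hL i) (ciInf_le (hdist i) (x i))
  refine le_antisymm ?_ (le_ciInf hlower)
  have hone : 0 ≤ N 1 := by
    have hzero : N 0 = 0 := by simpa using hhom 0 0
    exact hzero ▸ signInvariant_mono N hadd hhom hW (a := 0) (b := 1) fun i => by simp
  refine le_of_forall_pos_le_add fun ε hε => ?_
  have hδ : 0 < ε / (N 1 + 1) := by positivity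
  choose x hx using fun i => exists_lt_of_ciInf_lt
    (lt_add_of_pos_right (⨅ y : X i, dist y (g i y)) hδ)
  calc (⨅ x : ∀ i, X i, N (fun i => dist (x i) (g i (x i))))
      ≤ N (fun i => dist (x i) (g i (x i))) :=
        ciInf_le ⟨_, by rintro _ ⟨z, rfl⟩; exact hlower z⟩ x
    _ ≤ N ((fun i => ⨅ y : X i, dist y (g i y)) + (ε / (N 1 + 1)) • 1) :=
        signInvariant_mono N hadd hhom hW fun i =>
          abs_le_abs_of_nonneg dist_nonneg (by simpa using (hx i).le)
    _ ≤ N (fun i => ⨅ y : X i, dist y (g i y)) + ε / (N 1 + 1) * N 1 := by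
        refine (hadd _ _).trans_eq ?_
        rw [hhom, abs_of_pos hδ]
    _ ≤ N (fun i => ⨅ y : X i, dist y (g i y)) + ε := by
        gcongr
        rw [div_mul_eq_mul_div, div_le_iff₀ (by positivity)]
        nlinarith
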